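/- For every complex number s with 0 < Re(s) < 2, the improper integral ∫₀^∞ x^{-s-1}(1/cosh x − 1) dx converges and η(s+1, 1/2) = −π^s sin(πs/2) · ∫₀^∞ x^{-s-1}(1/cosh x − 1) dx. -/

import Mathlib

open Real MeasureTheory

/-- `η(s, 1/2) = ∑_{n=0}^∞ (-1)^n (n + 1/2)^(-s)`. -/
noncomputable def etaHalf (s : ℂ) : ℂ := ∑' n : ℕ, (-1 : ℂ) ^ n * ((n : ℂ) + 1 / 2) ^ (-s)

open Set

theorem image_div_one_sub_Ioo : (fun t : ℝ => t / (1 - t)) '' Ioo 0 1 = Ioi 0 := by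
  ext u
  simp only [mem_image, mem_Ioo, mem_Ioi]
  constructor
  · rintro ⟨t, ⟨h0, h1⟩, rfl⟩
    exact div_pos h0 (by linarith)
  · intro hu
    refine ⟨u / (1 + u), ⟨by positivity, (div_lt_one (by positivity)).2 (by linarith)⟩, ?_⟩
    have : 1 + u ≠ 0 := by positivity
    field_simp
    simp

theorem injOn_div_one_sub_Ioo : InjOn (fun t : ℝ => t / (1 - t)) (Ioo 0 1) := by
  intro x hx y hy h
  have h1 : 1 - x ≠ 0 := by linarith [hx.2]
  have h2 : 1 - y ≠ 0 := by linarith [hy.2]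
  have h3 := (div_eq_div_iff h1 h2).1 h
  linarith

theorem hasDerivAt_div_one_sub {t : ℝ} (ht : t < 1) :
    HasDerivAt (fun t : ℝ => t / (1 - t)) (1 / (1 - t) ^ 2) t := by
  have h : 1 - t ≠ 0 := by linarith
  convert! (hasDerivAt_id t).div ((hasDerivAt_id t).const_sub 1) h using 1
  simp

theorem mellin_integrand_comp_div_one_sub (w : ℂ) {t : ℝ} (h0 : 0 < t) (h1 : t < 1) :
    |1 / (1 - t) ^ 2| • (((t / (1 - t) : ℝ) : ℂ) ^ (w - 1) •
      ((1 / (1 + t / (1 - t)) : ℝ) : ℂ)) =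
      (t : ℂ) ^ (w - 1) * (1 - (t : ℂ)) ^ (1 - w - 1) := by
  have h : 0 < 1 - t := by linarith
  have hc : (1 - (t : ℂ)) ≠ 0 := by exact_mod_cast h.ne'
  have e1 : (1 : ℝ) / (1 + t / (1 - t)) = 1 - t := by field_simp; simp
  have e2 : (1 - (t : ℂ)) ^ (1 - w - 1) = (1 - (t : ℂ))⁻¹ / (1 - (t : ℂ)) ^ (w - 1) := by
    rw [show 1 - w - 1 = -1 - (w - 1) by ring, Complex.cpow_sub _ _ hc, Complex.cpow_neg_one]
  have hc' : (1 - (t : ℂ)) ^ (w - 1) ≠ 0 := by simp [Complex.cpow_eq_zero_iff, hc]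
  rw [e1, e2, abs_of_pos (by positivity), Complex.ofReal_div,
    Complex.div_cpow_ofReal_nonneg h0.le h.le, Complex.real_smul, smul_eq_mul]
  push_cast
  field_simp

/-- The Mellin transform of `1 / (1 + x)`. -/
theorem hasMellin_one_div_one_add {w : ℂ} (h0 : 0 < w.re) (h1 : w.re < 1) :
    HasMellin (fun x : ℝ => ((1 / (1 + x) : ℝ) : ℂ)) w (π / Complex.sin (π * w)) := by
  have h1' : 0 < (1 - w).re := by simpa using h1
  have hd : ∀ t ∈ Ioo (0 : ℝ) 1,
      HasDerivWithinAt (fun t : ℝ => t / (1 - t)) (1 / (1 - t) ^ 2) (Ioo 0 1) t :=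
    fun t ht => (hasDerivAt_div_one_sub ht.2).hasDerivWithinAt
  have hb := Complex.betaIntegral_convergent h0 h1'
  rw [intervalIntegrable_iff_integrableOn_Ioo_of_le zero_le_one] at hb
  constructor
  · rw [MellinConvergent, ← image_div_one_sub_Ioo,
      integrableOn_image_iff_integrableOn_abs_deriv_smul measurableSet_Ioo hd
        injOn_div_one_sub_Ioo]
    exact hb.congr_fun
      (fun t ht => (mellin_integrand_comp_div_one_sub w ht.1 ht.2).symm) measurableSet_Ioo
  · rw [mellin, ← image_div_one_sub_Ioo,
      integral_image_eq_integral_abs_deriv_smul measurableSet_Ioo hd injOn_div_one_sub_Ioo,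
      setIntegral_congr_fun measurableSet_Ioo
        (fun t ht => mellin_integrand_comp_div_one_sub w ht.1 ht.2),
      ← integral_Ioc_eq_integral_Ioo, ← intervalIntegral.integral_of_le zero_le_one]
    have := Complex.Gamma_mul_Gamma_eq_betaIntegral h0 h1'
    rw [add_sub_cancel, Complex.Gamma_one, one_mul, Complex.Gamma_mul_Gamma_one_sub] at this
    exact this.symm

/-- The Mellin transform of `1 / (a ^ 2 + x ^ 2)`. -/
theorem hasMellin_one_div_sq_add_sq {a : ℝ} (ha : 0 < a) {z : ℂ} (h0 : 0 < z.re)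
    (h1 : z.re < 2) :
    HasMellin (fun x : ℝ => ((1 / (a ^ 2 + x ^ 2) : ℝ) : ℂ)) z
      ((a : ℂ) ^ (z - 2) * (π / 2 / Complex.sin (π * z / 2))) := by
  have hw : HasMellin _ (z / (2 : ℝ)) _ := hasMellin_one_div_one_add (w := z / (2 : ℝ))
    (by rw [Complex.div_ofReal_re]; positivity)
    (by rw [Complex.div_ofReal_re]; linarith)
  have hf : (fun x : ℝ => ((1 / (a ^ 2 + x ^ 2) : ℝ) : ℂ)) = fun x : ℝ => ((a : ℂ) ^ 2)⁻¹ •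
      (fun y : ℝ => ((1 / (1 + y ^ (2 : ℝ)) : ℝ) : ℂ)) (a⁻¹ * x) := by
    funext x
    rw [smul_eq_mul, ← Complex.ofReal_pow, ← Complex.ofReal_inv, ← Complex.ofReal_mul]
    congr 1
    rw [Real.rpow_two]
    have : a ^ 2 + x ^ 2 ≠ 0 := by positivity
    have h2 : 1 + (a⁻¹ * x) ^ 2 ≠ 0 := by positivity
    field_simp
  have hsq := (MellinConvergent.comp_rpow (f := fun x : ℝ => ((1 / (1 + x) : ℝ) : ℂ))
    (two_ne_zero)).2 hw.1
  have hsc := (MellinConvergent.comp_mul_left (inv_pos.2 ha)).2 hsq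
  rw [hf]
  refine ⟨hsc.const_smul _, ?_⟩
  rw [mellin_const_smul, mellin_comp_mul_left (fun y : ℝ => ((1 / (1 + y ^ (2 : ℝ)) : ℝ) : ℂ)) _
      (inv_pos.2 ha),
    mellin_comp_rpow (fun x : ℝ => ((1 / (1 + x) : ℝ) : ℂ)), hw.2,
    Complex.cpow_sub _ _ (by exact_mod_cast ha.ne'), Complex.ofReal_inv,
    Complex.inv_cpow _ _ (by rw [Complex.arg_ofReal_of_nonneg ha.le]; exact pi_pos.ne),
    Complex.cpow_neg, inv_inv, Complex.cpow_ofNat, abs_two, Complex.real_smul]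
  simp only [smul_eq_mul]
  push_cast
  rw [mul_div_assoc (π : ℂ) z 2]
  ring

theorem one_div_add_mul_I_add_one_div_sub_mul_I {c y : ℝ} (hc : c ≠ 0) :
    1 / ((c : ℂ) + y * Complex.I) + 1 / ((c : ℂ) - y * Complex.I) =
      ((2 * c / (c ^ 2 + y ^ 2) : ℝ) : ℂ) := by
  have h1 : (c : ℂ) + y * Complex.I ≠ 0 := fun h => hc (by simpa using congrArg Complex.re h)
  have h2 : (c : ℂ) - y * Complex.I ≠ 0 := fun h => hc (by simpa using congrArg Complex.re h)
  have h3 : (c : ℂ) ^ 2 + (y : ℂ) ^ 2 ≠ 0 := by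
    have : c ^ 2 + y ^ 2 ≠ 0 := by positivity
    exact_mod_cast this
  have h4 : ((c : ℂ) + y * Complex.I) * ((c : ℂ) - y * Complex.I) = (c : ℂ) ^ 2 + (y : ℂ) ^ 2 := by
    linear_combination (-(y : ℂ) ^ 2) * Complex.I_sq
  rw [div_add_div _ _ h1 h2, h4]
  push_cast
  ring

theorem quarter_add_mem_integerComplement (y : ℝ) :
    (((1 / 4 : ℝ) : ℂ) + y * Complex.I) ∈ Complex.integerComplement := by
  rw [Complex.mem_integerComplement_iff]
  rintro ⟨n, hn⟩
  have h : (n : ℝ) = 1 / 4 := by simpa using congrArg Complex.re hn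
  have h' : (4 * n : ℤ) = 1 := by
    have : (4 * n : ℝ) = 1 := by linarith
    exact_mod_cast this
  omega

theorem cot_add_cot_of_add_eq_pi_div_two {a b : ℂ} (hab : a + b = π / 2)
    (ha : Complex.sin a ≠ 0) (hb : Complex.sin b ≠ 0) :
    Complex.cot a + Complex.cot b = 2 / Complex.cos (a - b) := by
  have hb' : b = π / 2 - a := by rw [← hab]; ring
  have h2 : a - b = 2 * a - π / 2 := by rw [hb']; ring
  rw [h2, Complex.cos_sub_pi_div_two, Complex.sin_two_mul, Complex.cot, Complex.cot]
  subst hb'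
  rw [Complex.sin_pi_div_two_sub] at hb ⊢
  rw [Complex.cos_pi_div_two_sub]
  field_simp
  linear_combination Complex.cos_sq_add_sin_sq a

theorem hasSum_cotTerm {x : ℂ} (hx : x ∈ Complex.integerComplement) :
    HasSum (cotTerm x) (π * Complex.cot (π * x) - 1 / x) := by
  rw [cot_series_rep' hx]
  exact (summable_cotTerm hx).hasSum

theorem hasSum_cotTerm_quarter (y : ℝ) :
    HasSum (fun n : ℕ => 2 * (1 / 4 - (n + 1)) / ((1 / 4 - (n + 1)) ^ 2 + y ^ 2) +
        2 * (1 / 4 + (n + 1)) / ((1 / 4 + (n + 1)) ^ 2 + y ^ 2) : ℕ → ℝ)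
      (2 * π / Real.cosh (2 * π * y) - 2 * (1 / 4) / ((1 / 4) ^ 2 + y ^ 2)) := by
  have hu := quarter_add_mem_integerComplement y
  have hv := quarter_add_mem_integerComplement (-y)
  have hsum := (hasSum_cotTerm hu).add (hasSum_cotTerm hv)
  have hq := one_div_add_mul_I_add_one_div_sub_mul_I (c := 1 / 4) (y := y) (by norm_num)
  have hcot := cot_add_cot_of_add_eq_pi_div_two (a := π * (((1 / 4 : ℝ) : ℂ) + y * Complex.I))
    (b := π * (((1 / 4 : ℝ) : ℂ) + (-y : ℝ) * Complex.I)) (by push_cast; ring)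
    (sin_pi_mul_ne_zero hu) (sin_pi_mul_ne_zero hv)
  rw [show (π : ℂ) * (((1 / 4 : ℝ) : ℂ) + y * Complex.I) -
    π * (((1 / 4 : ℝ) : ℂ) + (-y : ℝ) * Complex.I) = ((2 * π * y : ℝ) : ℂ) * Complex.I by
      push_cast; ring, Complex.cos_mul_I] at hcot
  rw [← Complex.hasSum_ofReal]
  convert! hsum using 1
  · funext n
    have hm := one_div_add_mul_I_add_one_div_sub_mul_I (c := 1 / 4 - (n + 1)) (y := y)
      (by have : (0 : ℝ) ≤ n := n.cast_nonneg
          linarith)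
    have hp := one_div_add_mul_I_add_one_div_sub_mul_I (c := 1 / 4 + (n + 1)) (y := y)
      (by positivity)
    rw [Complex.ofReal_add, ← hm, ← hp, cotTerm, cotTerm]
    push_cast
    ring_nf
  · rw [Complex.ofReal_sub, ← hq]
    push_cast at hcot ⊢
    linear_combination (-(π : ℂ)) * hcot

theorem summable_alternating_div_cubic (x : ℝ) :
    Summable fun n : ℕ => (-1 : ℝ) ^ n *
      (x ^ 2 / (((n + 1 / 2) * π) * (((n + 1 / 2) * π) ^ 2 + x ^ 2))) := by
  have hs : Summable fun n : ℕ => x ^ 2 * (1 / ((n + 1 : ℕ) : ℝ) ^ 2) :=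
    ((summable_nat_add_iff 1).2 (Real.summable_one_div_nat_pow.2 one_lt_two)).mul_left _
  refine hs.of_norm_bounded fun n => ?_
  rw [norm_mul, norm_pow, norm_neg, norm_one, one_pow, one_mul, Real.norm_of_nonneg (by positivity),
    mul_one_div]
  have hn : (0 : ℝ) ≤ n := n.cast_nonneg
  have ha : (n + 1 : ℝ) ≤ (n + 1 / 2) * π := by nlinarith [pi_gt_three]
  push_cast
  gcongr
  nlinarith [mul_le_mul ha ha (by positivity) (by positivity), sq_nonneg x,
    mul_nonneg (sub_nonneg.2 ha) (sq_nonneg x), mul_nonneg hn (sq_nonneg x),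
    mul_nonneg (show 0 ≤ (n + 1 / 2) * π - 1 by linarith) (sq_nonneg ((n + 1 / 2) * π))]

/-- The Mittag-Leffler expansion of `1 - 1 / cosh x`. -/
theorem hasSum_one_sub_one_div_cosh (x : ℝ) :
    HasSum (fun n : ℕ => (-1 : ℝ) ^ n *
      (x ^ 2 / (((n + 1 / 2) * π) * (((n + 1 / 2) * π) ^ 2 + x ^ 2))))
      ((1 - 1 / Real.cosh x) / 2) := by
  have hf := summable_alternating_div_cubic x
  set f : ℕ → ℝ := fun n => (-1 : ℝ) ^ n *
    (x ^ 2 / (((n + 1 / 2) * π) * (((n + 1 / 2) * π) ^ 2 + x ^ 2))) with hfdef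
  have hodd : Summable fun k : ℕ => f (2 * k + 1) :=
    hf.comp_injective fun a b h => by simpa using h
  have heven : Summable fun k : ℕ => f (2 * (k + 1)) :=
    hf.comp_injective fun a b h => by simpa using h
  have h0 : f 0 = 2 * x ^ 2 / (π * ((π / 2) ^ 2 + x ^ 2)) := by
    simp only [hfdef]
    norm_num
    field_simp
  have hpair : HasSum (fun k : ℕ => f (2 * k + 1) + f (2 * (k + 1)))
      ((1 - 1 / Real.cosh x) / 2 - f 0) := by
    have hx := (hasSum_cotTerm_quarter (x / (2 * π))).sub (hasSum_cotTerm_quarter 0)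
    convert! hx.mul_left (-1 / (4 * π)) using 1
    · funext k
      have hk : (0 : ℝ) ≤ k := k.cast_nonneg
      have e2 : (1 / 4 - ((k : ℝ) + 1)) ≠ 0 := by linarith
      have e3 : (1 / 4 - ((k : ℝ) + 1)) ^ 2 + (x / (2 * π)) ^ 2 ≠ 0 := by positivity
      have e4 : (1 / 4 + ((k : ℝ) + 1)) ≠ 0 := by positivity
      have e5 : (1 / 4 + ((k : ℝ) + 1)) ^ 2 + (x / (2 * π)) ^ 2 ≠ 0 := by positivity
      have o : f (2 * k + 1) = -1 / (4 * π) * (2 * (1 / 4 - (k + 1)) /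
          ((1 / 4 - (k + 1)) ^ 2 + (x / (2 * π)) ^ 2) - 2 / (1 / 4 - (k + 1))) := by
        simp only [hfdef]
        rw [pow_succ, pow_mul]
        push_cast
        have e7 : ((2 * (k : ℝ) + 1 + 1 / 2) * π) ^ 2 + x ^ 2 =
          (4 * π ^ 2) * ((1 / 4 - ((k : ℝ) + 1)) ^ 2 + (x / (2 * π)) ^ 2) := by
          field_simp; ring
        have e8 : (2 * (k : ℝ) + 1 + 1 / 2) = -2 * (1 / 4 - ((k : ℝ) + 1)) := by ring
        rw [e7, e8]
        generalize (1 / 4 - ((k : ℝ) + 1)) = c at *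
        have e9 : x ^ 2 = 4 * π ^ 2 * (c ^ 2 + (x / (2 * π)) ^ 2) - 4 * π ^ 2 * c ^ 2 := by
          field_simp; ring
        rw [e9]
        generalize c ^ 2 + (x / (2 * π)) ^ 2 = d at *
        field_simp
        ring
      have e : f (2 * (k + 1)) = -1 / (4 * π) * (2 * (1 / 4 + (k + 1)) /
          ((1 / 4 + (k + 1)) ^ 2 + (x / (2 * π)) ^ 2) - 2 / (1 / 4 + (k + 1))) := by
        simp only [hfdef]
        rw [pow_mul]
        push_cast
        have e7 : ((2 * ((k : ℝ) + 1) + 1 / 2) * π) ^ 2 + x ^ 2 =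
          (4 * π ^ 2) * ((1 / 4 + ((k : ℝ) + 1)) ^ 2 + (x / (2 * π)) ^ 2) := by
          field_simp; ring
        have e8 : (2 * ((k : ℝ) + 1) + 1 / 2) = 2 * (1 / 4 + ((k : ℝ) + 1)) := by ring
        rw [e7, e8]
        generalize (1 / 4 + ((k : ℝ) + 1)) = c at *
        have e9 : x ^ 2 = 4 * π ^ 2 * (c ^ 2 + (x / (2 * π)) ^ 2) - 4 * π ^ 2 * c ^ 2 := by
          field_simp; ring
        rw [e9]
        generalize c ^ 2 + (x / (2 * π)) ^ 2 = d at *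
        field_simp
        ring
      rw [o, e]
      generalize (1 / 4 - ((k : ℝ) + 1)) = c at *
      generalize (1 / 4 + ((k : ℝ) + 1)) = d at *
      have hc : 2 * c / (c ^ 2 + 0 ^ 2) = 2 / c := by field_simp; simp
      have hd : 2 * d / (d ^ 2 + 0 ^ 2) = 2 / d := by field_simp; simp
      rw [hc, hd]
      ring
    · rw [h0, show 2 * π * (x / (2 * π)) = x by field_simp]
      have hcosh := (Real.cosh_pos x).ne'
      have e1 : (1 / 4 : ℝ) ^ 2 + (x / (2 * π)) ^ 2 = ((π / 2) ^ 2 + x ^ 2) / (4 * π ^ 2) := by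
        field_simp; ring
      rw [e1, mul_zero, Real.cosh_zero]
      have e2 : (π / 2) ^ 2 + x ^ 2 ≠ 0 := by positivity
      rw [show 2 * x ^ 2 = 2 * (((π / 2) ^ 2 + x ^ 2) - (π / 2) ^ 2) by ring]
      generalize (π / 2) ^ 2 + x ^ 2 = d at *
      field_simp
      ring
  have h1 : HasSum (fun n => f (n + 1)) ((1 - 1 / Real.cosh x) / 2 - f 0) := by
    rw [← (hodd.hasSum.add heven.hasSum).unique hpair]
    exact hodd.hasSum.even_add_odd heven.hasSum
  simpa using (hasSum_nat_add_iff 1).1 h1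

theorem one_sub_one_div_cosh_nonneg (x : ℝ) : 0 ≤ 1 - 1 / Real.cosh x := by
  rw [sub_nonneg, div_le_one (Real.cosh_pos x)]
  exact Real.one_le_cosh x

theorem one_sub_one_div_cosh_le (x : ℝ) :
    1 - 1 / Real.cosh x ≤ 2 * (x ^ 2 * (1 / (1 ^ 2 + x ^ 2))) := by
  have hc := Real.cosh_pos x
  have h1 : 0 < 1 / Real.cosh x := by positivity
  have h2 : 1 - x ^ 2 / 2 ≤ 1 / Real.cosh x := by
    have h3 : Real.exp (-(x ^ 2 / 2)) ≤ 1 / Real.cosh x := by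
      rw [Real.exp_neg, one_div]
      exact inv_anti₀ hc (Real.cosh_le_exp_half_sq x)
    linarith [Real.add_one_le_exp (-(x ^ 2 / 2))]
  rw [mul_one_div, ← mul_div_assoc, le_div_iff₀ (by positivity)]
  nlinarith [sq_nonneg x]

theorem integrableOn_cpow_mul_one_div_cosh_sub_one {s : ℂ} (h0 : 0 < s.re) (h1 : s.re < 2) :
    IntegrableOn (fun x : ℝ => (x : ℂ) ^ (-s - 1) *
      ((1 / Real.cosh x - 1 : ℝ) : ℂ)) (Ioi 0) := by
  have hm : MellinConvergent (fun x : ℝ => ((1 / (1 ^ 2 + x ^ 2) : ℝ) : ℂ)) (2 - s) :=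
    (hasMellin_one_div_sq_add_sq one_pos (z := 2 - s) (by simpa using h1) (by simpa using h0)).1
  refine (Integrable.smul (2 : ℝ) hm).mono (ContinuousOn.aestronglyMeasurable ?_
    measurableSet_Ioi) ?_
  · refine ContinuousOn.mul (fun x hx => ?_) ?_
    · exact (Complex.continuousAt_ofReal_cpow_const _ _
        (Or.inr (ne_of_gt hx))).continuousWithinAt
    · refine (Complex.continuous_ofReal.comp ?_).continuousOn
      exact (continuous_const.div Real.continuous_cosh
        fun x => (Real.cosh_pos x).ne').sub continuous_const
  · refine (ae_restrict_iff' measurableSet_Ioi).2 (ae_of_all _ fun x (hx : 0 < x) => ?_)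
    have hp : x ^ (-s.re - 1) * x ^ 2 = x ^ (2 - s.re - 1) := by
      rw [← Real.rpow_natCast, ← Real.rpow_add hx]
      congr 1
      push_cast
      ring
    rw [Pi.smul_apply, norm_smul, norm_smul, norm_mul, Complex.norm_cpow_eq_rpow_re_of_pos hx,
      Complex.norm_cpow_eq_rpow_re_of_pos hx, Complex.norm_real, Complex.norm_real, norm_sub_rev,
      Real.norm_of_nonneg (one_sub_one_div_cosh_nonneg x),
      Real.norm_of_nonneg (by positivity : 0 ≤ 1 / (1 ^ 2 + x ^ 2))]
    simp only [Complex.sub_re, Complex.neg_re, Complex.one_re, Complex.re_ofNat]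
    calc x ^ (-s.re - 1) * (1 - 1 / Real.cosh x)
        ≤ x ^ (-s.re - 1) * (2 * (x ^ 2 * (1 / (1 ^ 2 + x ^ 2)))) := by
          gcongr
          exact one_sub_one_div_cosh_le x
      _ = ‖(2 : ℝ)‖ * (x ^ (2 - s.re - 1) * (1 / (1 ^ 2 + x ^ 2))) := by
          rw [← hp, Real.norm_of_nonneg zero_le_two]
          ring

theorem hasMellin_sq_div {a : ℝ} (ha : 0 < a) {s : ℂ} (h0 : 0 < s.re) (h1 : s.re < 2) :
    HasMellin (fun x : ℝ => ((x ^ 2 / (a * (a ^ 2 + x ^ 2)) : ℝ) : ℂ)) (-s)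
      ((a : ℂ) ^ (-(s + 1)) * (π / 2 / Complex.sin (π * s / 2))) := by
  have hm := hasMellin_one_div_sq_add_sq ha (z := 2 - s) (by simpa using h1) (by simpa using h0)
  have hf : (fun x : ℝ => ((x ^ 2 / (a * (a ^ 2 + x ^ 2)) : ℝ) : ℂ)) = fun x : ℝ =>
      (x : ℂ) ^ (2 : ℂ) • (((a : ℂ)⁻¹) • ((1 / (a ^ 2 + x ^ 2) : ℝ) : ℂ)) := by
    funext x
    have : (x : ℂ) ^ (2 : ℂ) = (x : ℂ) ^ 2 := by norm_cast
    rw [this]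
    push_cast
    simp only [smul_eq_mul]
    rw [div_eq_mul_inv, mul_inv]
    ring
  have ha' : (a : ℂ) ≠ 0 := by exact_mod_cast ha.ne'
  rw [hf]
  refine ⟨?_, ?_⟩
  · rw [MellinConvergent.cpow_smul, show -s + 2 = 2 - s by ring]
    exact hm.1.const_smul _
  · rw [mellin_cpow_smul, show -s + 2 = 2 - s by ring, mellin_const_smul, hm.2,
      show 2 - s - 2 = -s by ring, show (π : ℂ) * (2 - s) / 2 = π - π * s / 2 by ring,
      Complex.sin_pi_sub, show -(s + 1) = -s - 1 by ring, Complex.cpow_sub _ _ ha',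
      Complex.cpow_one, smul_eq_mul]
    ring

theorem summable_add_half_mul_pi_rpow {r : ℝ} (hr : 1 < r) :
    Summable fun n : ℕ => (((n : ℝ) + 1 / 2) * π) ^ (-r) := by
  have hs : Summable fun n : ℕ => ((n + 1 : ℕ) : ℝ) ^ (-r) :=
    (summable_nat_add_iff 1).2 (Real.summable_nat_rpow.2 (by linarith))
  refine hs.of_nonneg_of_le (fun n => by positivity) fun n => ?_
  have hn : (0 : ℝ) ≤ n := n.cast_nonneg
  refine Real.rpow_le_rpow_of_nonpos (by positivity) ?_ (by linarith)
  push_cast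
  nlinarith [pi_gt_three]

theorem integral_norm_cpow_mul_sq_div {a : ℝ} (ha : 0 < a) {s : ℂ} (h0 : 0 < s.re)
    (h1 : s.re < 2) :
    ∫ x in Ioi (0 : ℝ), ‖(x : ℂ) ^ (-s - 1) * ((x ^ 2 / (a * (a ^ 2 + x ^ 2)) : ℝ) : ℂ)‖ =
      a ^ (-(s.re + 1)) * ‖(π / 2 / Complex.sin (π * s.re / 2) : ℂ)‖ := by
  have hm := (hasMellin_sq_div ha (s := (s.re : ℂ)) (by simpa using h0) (by simpa using h1)).2
  have hi : mellin (fun x : ℝ => ((x ^ 2 / (a * (a ^ 2 + x ^ 2)) : ℝ) : ℂ)) (-(s.re : ℂ)) =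
      ((∫ x in Ioi (0 : ℝ), ‖(x : ℂ) ^ (-s - 1) *
        ((x ^ 2 / (a * (a ^ 2 + x ^ 2)) : ℝ) : ℂ)‖ : ℝ) : ℂ) := by
    rw [mellin, ← integral_complex_ofReal]
    refine setIntegral_congr_fun measurableSet_Ioi fun x (hx : 0 < x) => ?_
    simp only [norm_mul, Complex.norm_cpow_eq_rpow_re_of_pos hx, Complex.norm_real]
    rw [Real.norm_of_nonneg (by positivity), Complex.ofReal_mul, Complex.ofReal_cpow hx.le,
      smul_eq_mul]
    simp
  have hn := congrArg norm (hi.symm.trans hm)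
  rw [Complex.norm_real, Real.norm_of_nonneg (integral_nonneg fun x => norm_nonneg _), norm_mul,
    Complex.norm_cpow_eq_rpow_re_of_pos ha] at hn
  simpa using hn

theorem sin_pi_mul_div_two_ne_zero {s : ℂ} (h0 : 0 < s.re) (h1 : s.re < 2) :
    Complex.sin (π * s / 2) ≠ 0 := by
  rw [mul_div_assoc]
  refine sin_pi_mul_ne_zero ?_
  rw [Complex.mem_integerComplement_iff]
  rintro ⟨n, hn⟩
  have h : (n : ℝ) = s.re / 2 := by simpa using congrArg Complex.re hn
  have hn0 : (0 : ℝ) < n := by linarith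
  have hn1 : (n : ℝ) < 1 := by linarith
  norm_cast at hn0 hn1
  omega

theorem hasSum_integral_cpow_mul_one_sub_one_div_cosh {s : ℂ} (h0 : 0 < s.re) (h1 : s.re < 2) :
    HasSum (fun n : ℕ => (-1 : ℂ) ^ n * (((((n : ℝ) + 1 / 2) * π : ℝ) : ℂ) ^ (-(s + 1)) *
        (π / 2 / Complex.sin (π * s / 2))))
      (∫ x in Ioi (0 : ℝ), (x : ℂ) ^ (-s - 1) * (((1 - 1 / Real.cosh x) / 2 : ℝ) : ℂ)) := by
  set a : ℕ → ℝ := fun n => ((n : ℝ) + 1 / 2) * π with hadef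
  have ha : ∀ n, 0 < a n := fun n => by positivity
  have hm := fun n => hasMellin_sq_div (ha n) h0 h1
  have hsum := hasSum_integral_of_summable_integral_norm (μ := volume.restrict (Ioi (0 : ℝ)))
    (F := fun (n : ℕ) (x : ℝ) => (-1 : ℂ) ^ n * ((x : ℂ) ^ (-s - 1) *
      ((x ^ 2 / (a n * (a n ^ 2 + x ^ 2)) : ℝ) : ℂ)))
    (fun n => Integrable.const_mul (hm n).1 _) ?_
  · convert! hsum using 1
    · funext n
      rw [integral_const_mul, ← (hm n).2]
      rfl
    · refine setIntegral_congr_fun measurableSet_Ioi fun x _ => ?_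
      have hx := ((Complex.hasSum_ofReal.2 (hasSum_one_sub_one_div_cosh x)).mul_left
        ((x : ℂ) ^ (-s - 1))).tsum_eq
      rw [← hx]
      refine tsum_congr fun n => ?_
      simp only [hadef]
      push_cast
      ring
  · simp only [norm_mul, norm_pow, norm_neg, norm_one, one_pow, one_mul]
    simp only [← norm_mul, integral_norm_cpow_mul_sq_div (ha _) h0 h1]
    exact (summable_add_half_mul_pi_rpow (by linarith)).mul_right _

/-- For every complex `s` with `0 < Re s < 2`, the integral
`∫₀^∞ x^(-s-1) (1/cosh x - 1) dx` converges and
`η(s+1, 1/2) = -π^s sin(πs/2) · ∫₀^∞ x^(-s-1) (1/cosh x - 1) dx`. -/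
theorem etaHalf_sech_integral_rep (s : ℂ) (h0 : 0 < s.re) (h1 : s.re < 2) :
    IntegrableOn (fun x : ℝ => (x : ℂ) ^ (-s - 1) *
      ((1 / Real.cosh x - 1 : ℝ) : ℂ)) (Set.Ioi 0) ∧
    etaHalf (s + 1) = -(π : ℂ) ^ s * Complex.sin ((π : ℂ) * s / 2) *
      ∫ x in Set.Ioi (0 : ℝ), (x : ℂ) ^ (-s - 1) *
        ((1 / Real.cosh x - 1 : ℝ) : ℂ) := by
  refine ⟨integrableOn_cpow_mul_one_div_cosh_sub_one h0 h1, ?_⟩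
  have hs := (hasSum_integral_cpow_mul_one_sub_one_div_cosh h0 h1).tsum_eq
  have hsin := sin_pi_mul_div_two_ne_zero h0 h1
  have hpi : (π : ℂ) ≠ 0 := by exact_mod_cast pi_pos.ne'
  have hpow : (π : ℂ) ^ s ≠ 0 := by simp [Complex.cpow_eq_zero_iff, hpi]
  have hL : ∑' n : ℕ, (-1 : ℂ) ^ n * (((((n : ℝ) + 1 / 2) * π : ℝ) : ℂ) ^ (-(s + 1)) *
      (π / 2 / Complex.sin (π * s / 2))) =
      etaHalf (s + 1) * ((π : ℂ) ^ (-(s + 1)) * (π / 2 / Complex.sin (π * s / 2))) := by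
    rw [etaHalf, ← tsum_mul_right]
    refine tsum_congr fun n => ?_
    rw [Complex.ofReal_mul, Complex.mul_cpow_ofReal_nonneg (by positivity) pi_pos.le]
    push_cast
    ring
  have hR : ∫ x in Ioi (0 : ℝ), (x : ℂ) ^ (-s - 1) * (((1 - 1 / Real.cosh x) / 2 : ℝ) : ℂ) =
      (-1 / 2) * ∫ x in Ioi (0 : ℝ), (x : ℂ) ^ (-s - 1) *
        ((1 / Real.cosh x - 1 : ℝ) : ℂ) := by
    rw [← integral_const_mul]
    congr 1
    funext x
    push_cast
    ring
  have hp : (π : ℂ) ^ (-(s + 1)) = ((π : ℂ) ^ s * π)⁻¹ := by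
    rw [Complex.cpow_neg, Complex.cpow_add _ _ hpi, Complex.cpow_one]
  rw [hL, hR, hp] at hs
  generalize ∫ x in Ioi (0 : ℝ), (x : ℂ) ^ (-s - 1) * ((1 / Real.cosh x - 1 : ℝ) : ℂ) = J at *
  generalize Complex.sin ((π : ℂ) * s / 2) = S at *
  field_simp at hs
  linear_combination hs
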